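/- arXiv:2508.14605 — 5 statements merged into one kernel-verified Lean document; each statement's English description precedes it below -/
import Mathlib

section
/- Let E be a binary matrix (a function I × I → {0,1} for a finite index set I) such that every row and every column contains exactly two nonzero entries. Then there exists a partition of the set of nonzero entries (positions (i,j) with E(i,j) = 1) into two subsets such that each row contains exactly one entry from each subset and each column contains exactly one entry from each subset. -/
/-- A relation on a finite type in which every row and every column has exactly two related
entries contains the graph of a permutation. -/
theorem exists_perm_of_card_eq_two {I : Type*} [Fintype I] [DecidableEq I] (r : I → I → Prop)
    [∀ i j, Decidable (r i j)]
    (hrow : ∀ i, (Finset.univ.filter (fun j => r i j)).card = 2)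
    (hcol : ∀ j, (Finset.univ.filter (fun i => r i j)).card = 2) :
    ∃ σ : Equiv.Perm I, ∀ i, r i (σ i) := by
  have hall : ∀ s : Finset I,
      s.card ≤ (s.biUnion fun i => Finset.univ.filter (fun j => r i j)).card := by
    intro s
    refine Nat.le_of_mul_le_mul_right (Finset.card_mul_le_card_mul r (m := 2) (n := 2)
      (fun i hi => ?_) fun j _ => ?_) two_pos
    · rw [← hrow i]
      refine Finset.card_le_card fun j hj => ?_
      simp only [Finset.mem_filter, Finset.mem_univ, true_and] at hj
      simp only [Finset.mem_bipartiteAbove, Finset.mem_biUnion, Finset.mem_filter,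
        Finset.mem_univ, true_and]
      exact ⟨⟨i, hi, hj⟩, hj⟩
    · rw [← hcol j]
      exact Finset.card_le_card (Finset.filter_subset_filter _ (Finset.subset_univ s))
  obtain ⟨f, hf, hfr⟩ := (Finset.all_card_le_biUnion_card_iff_exists_injective _).1 hall
  exact ⟨Equiv.ofBijective f (Finite.injective_iff_bijective.1 hf),
    fun i => (Finset.mem_filter.1 (hfr i)).2⟩

/-- A binary matrix (over a finite index set `I`) with exactly two
nonzero entries in each row and each column admits a partition of its nonzero
entries into two subsets such that each row and each column contains exactly one
entry from each subset. -/
theorem stmt_1 {I : Type*} [Fintype I] [DecidableEq I] (E : I × I → Fin 2)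
    (hrow : ∀ i, (Finset.univ.filter (fun j => E (i, j) = 1)).card = 2)
    (hcol : ∀ j, (Finset.univ.filter (fun i => E (i, j) = 1)).card = 2) :
    ∃ S T : Finset (I × I),
      Disjoint S T ∧
      S ∪ T = Finset.univ.filter (fun p => E p = 1) ∧
      (∀ i, (S.filter (fun p => p.1 = i)).card = 1 ∧
            (T.filter (fun p => p.1 = i)).card = 1) ∧
      (∀ j, (S.filter (fun p => p.2 = j)).card = 1 ∧
            (T.filter (fun p => p.2 = j)).card = 1) := by
  obtain ⟨σ, hσ⟩ := exists_perm_of_card_eq_two (fun i j => E (i, j) = 1) hrow hcol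
  set M : Finset (I × I) := Finset.univ.filter (fun p => E p = 1) with hM
  set S : Finset (I × I) := Finset.univ.filter (fun p => p.2 = σ p.1) with hS
  have hSM : S ⊆ M := by
    rintro ⟨i, j⟩ h
    obtain rfl : j = σ i := by simpa [hS] using h
    simpa [hM] using hσ i
  have compl_card (q : I × I → Prop) [DecidablePred q] (hMq : (M.filter q).card = 2)
      (hSq : (S.filter q).card = 1) : ((M \ S).filter q).card = 1 := by
    have hsdiff : (M \ S).filter q = M.filter q \ S.filter q := by
      ext p
      simp only [Finset.mem_filter, Finset.mem_sdiff]
      tauto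
    rw [hsdiff, Finset.card_sdiff_of_subset (Finset.filter_subset_filter _ hSM), hMq, hSq]
  have hSrow (i : I) : (S.filter (fun p => p.1 = i)).card = 1 := by
    refine Finset.card_eq_one.2 ⟨(i, σ i), ?_⟩
    ext ⟨a, b⟩
    simp only [hS, Finset.mem_filter, Finset.mem_univ, true_and, Finset.mem_singleton,
      Prod.mk.injEq]
    grind
  have hScol (j : I) : (S.filter (fun p => p.2 = j)).card = 1 := by
    refine Finset.card_eq_one.2 ⟨(σ.symm j, j), ?_⟩
    ext ⟨a, b⟩
    simp only [hS, Finset.mem_filter, Finset.mem_univ, true_and, Finset.mem_singleton,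
      Prod.mk.injEq, Equiv.eq_symm_apply]
    grind
  have hMrow (i : I) : (M.filter (fun p => p.1 = i)).card = 2 := by
    rw [← hrow i, ← Finset.card_map (Function.Embedding.sectR i I)]
    congr 1
    ext ⟨a, b⟩
    simp only [hM, Finset.mem_filter, Finset.mem_univ, true_and, Finset.mem_map,
      Function.Embedding.sectR_apply, Prod.mk.injEq]
    grind
  have hMcol (j : I) : (M.filter (fun p => p.2 = j)).card = 2 := by
    rw [← hcol j, ← Finset.card_map (Function.Embedding.sectL I j)]
    congr 1
    ext ⟨a, b⟩
    simp only [hM, Finset.mem_filter, Finset.mem_univ, true_and, Finset.mem_map,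
      Function.Embedding.sectL_apply, Prod.mk.injEq]
    grind
  exact ⟨S, M \ S, Finset.disjoint_sdiff, Finset.union_sdiff_of_subset hSM,
    fun i => ⟨hSrow i, compl_card _ (hMrow i) (hSrow i)⟩,
    fun j => ⟨hScol j, compl_card _ (hMcol j) (hScol j)⟩⟩
end

section
/- There exists a constant C > 0 such that for every even integer n ≥ 4, log₂(b_n) ≥ n·2^{n/2} − C·2^{n/2}, where b_n is the number of bent functions in n variables. (This is the asymptotic statement log₂ b_n ≥ n·2^{n/2}(1 + O(1/n)).) -/
/-- `𝔽₂ⁿ`, the space of binary vectors of length `n`. -/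
abbrev BV (n : ℕ) : Type := Fin n → ZMod 2

/-- The inner product `⟨x, y⟩ = ⊕ᵢ xᵢ yᵢ` on `𝔽₂ⁿ`. -/
def ip {n : ℕ} (x y : BV n) : ZMod 2 := ∑ i, x i * y i

/-- The Walsh transform `W_f(y) = ∑_{x} (−1)^{f(x) ⊕ ⟨x,y⟩}` of a Boolean function. -/
def walsh {n : ℕ} (f : BV n → ZMod 2) (y : BV n) : ℤ :=
  ∑ x : BV n, (-1 : ℤ) ^ ((f x + ip x y).val)

/-- A Boolean function in `n` variables (`n` even) is bent if `|W_f(y)| = 2^{n/2}`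
for all `y`. -/
def IsBent (n : ℕ) (f : BV n → ZMod 2) : Prop :=
  ∀ y : BV n, |walsh f y| = 2 ^ (n / 2)

/-- `b_n`, the number of bent functions in `n` variables. -/
noncomputable def bentCount (n : ℕ) : ℕ :=
  Nat.card {f : BV n → ZMod 2 // IsBent n f}

/-- The sign character `a ↦ (-1)^a` of `𝔽₂`. -/
def signChar (a : ZMod 2) : ℤ := (-1) ^ a.val

lemma signChar_add (a b : ZMod 2) : signChar (a + b) = signChar a * signChar b := by
  revert a b; decide

lemma signChar_injective : Function.Injective signChar := by
  unfold Function.Injective; decide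

lemma abs_signChar (a : ZMod 2) : |signChar a| = 1 := by
  revert a; decide

lemma ip_comm {n : ℕ} (x y : BV n) : ip x y = ip y x := by
  simp [ip, mul_comm]

lemma ip_add {n : ℕ} (x y z : BV n) : ip x (y + z) = ip x y + ip x z := by
  simp [ip, mul_add, Finset.sum_add_distrib]

lemma ip_single {n : ℕ} (x : BV n) (i : Fin n) : ip x (Pi.single i 1) = x i := by
  simp [ip, Pi.single_apply]

lemma ip_left_injective {n : ℕ} {x y : BV n} (h : ∀ z, ip x z = ip y z) : x = y := by
  funext i
  simpa [ip_single] using h (Pi.single i 1)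

lemma sum_ip_left {ι : Type*} {n : ℕ} (s : Finset ι) (x : ι → BV n) (y : BV n) :
    ∑ i ∈ s, ip (x i) y = ip (∑ i ∈ s, x i) y := by
  simp only [ip, Finset.sum_apply, Finset.sum_mul]
  exact Finset.sum_comm

lemma add_self_eq_zero_BV {n : ℕ} (x : BV n) : x + x = 0 := by
  funext i; exact CharTwo.add_self_eq_zero (x i)

lemma sum_signChar_ip {n : ℕ} (a : BV n) :
    ∑ x : BV n, signChar (ip x a) = if a = 0 then 2 ^ n else 0 := by
  split_ifs with h
  · subst h
    simp [ip, signChar]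
  · obtain ⟨i, hi⟩ := Function.ne_iff.mp h
    have hi1 : a i = 1 := by
      have h01 : ∀ c : ZMod 2, c ≠ 0 → c = 1 := by decide
      exact h01 _ hi
    have key := Equiv.sum_comp (Equiv.addRight (Pi.single i 1 : BV n))
      (fun x => signChar (ip x a))
    have hneg : ∀ x : BV n, signChar (ip (x + Pi.single i 1) a) = -signChar (ip x a) := by
      intro x
      rw [ip_comm, ip_add, ip_single, hi1, signChar_add, ip_comm a x]
      simp [signChar, ZMod.val_one]
    simp only [Equiv.coe_addRight, hneg, Finset.sum_neg_distrib] at key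
    lia

lemma sum_BV_two {M : Type*} [AddCommMonoid M] (F : BV 2 → M) :
    ∑ p, F p = (F ![0, 0] + F ![0, 1]) + (F ![1, 0] + F ![1, 1]) := by
  rw [← (finTwoArrowEquiv (ZMod 2)).symm.sum_comp, Fintype.sum_prod_type]
  exact (Fin.sum_univ_two _).trans (congrArg₂ _ (Fin.sum_univ_two _) (Fin.sum_univ_two _))

/-- The quadratic form `p ↦ p₀ p₁` on `𝔽₂²`. -/
def quad (p : BV 2) : ZMod 2 := p 0 * p 1

lemma sum_quad : ∑ p, quad p = 1 := by
  rw [sum_BV_two]; decide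

/-- The dual of a bent function in two variables. -/
def dualTwo (h : BV 2 → ZMod 2) (k : BV 2) : ZMod 2 :=
  if ∑ p, signChar (h p + ip p k) = 2 then 0 else 1

lemma abs_sum_signs_of_odd (a b c d k l : ZMod 2) (h : (a + b) + (c + d) = 1) :
    |(signChar a + signChar (b + l)) + (signChar (c + k) + signChar (d + (k + l)))| = 2 := by
  revert a b c d k l; decide

lemma abs_walsh_two {h : BV 2 → ZMod 2} (hh : ∑ p, h p = 1) (k : BV 2) :
    |∑ p, signChar (h p + ip p k)| = 2 := by
  rw [sum_BV_two] at hh ⊢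
  simpa [ip] using abs_sum_signs_of_odd _ _ _ _ (k 0) (k 1) hh

lemma walsh_two_eq_dual {h : BV 2 → ZMod 2} (hh : ∑ p, h p = 1) (k : BV 2) :
    ∑ p, signChar (h p + ip p k) = 2 * signChar (dualTwo h k) := by
  have := abs_walsh_two hh k
  unfold dualTwo
  split_ifs with h2
  · simpa [signChar] using h2
  · rcases (abs_eq (by norm_num)).mp this with h3 | h3
    · exact absurd h3 h2
    · rw [h3]; decide

lemma walsh_dualTwo {h : BV 2 → ZMod 2} (hh : ∑ p, h p = 1) (p : BV 2) :
    ∑ k, signChar (dualTwo h k + ip k p) = 2 * signChar (h p) := by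
  have key : 2 * ∑ k, signChar (dualTwo h k + ip k p) = 4 * signChar (h p) := by
    calc 2 * ∑ k, signChar (dualTwo h k + ip k p)
        = ∑ k, ∑ r, signChar (h r) * signChar (ip k (r + p)) := by
          rw [Finset.mul_sum]
          refine Finset.sum_congr rfl fun k _ => ?_
          rw [signChar_add, ← mul_assoc, ← walsh_two_eq_dual hh, Finset.sum_mul]
          refine Finset.sum_congr rfl fun r _ => ?_
          rw [signChar_add, ip_add, signChar_add, ip_comm r k, mul_assoc]
      _ = ∑ r, if r = p then 4 * signChar (h p) else 0 := by
          rw [Finset.sum_comm]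
          refine Finset.sum_congr rfl fun r _ => ?_
          rw [← Finset.mul_sum, sum_signChar_ip]
          have : r + p = 0 ↔ r = p := by
            constructor
            · intro hrp
              rw [← add_zero r, ← add_self_eq_zero_BV p, ← add_assoc, hrp, zero_add]
            · rintro rfl; exact add_self_eq_zero_BV r
          by_cases hr : r = p
          · rw [if_pos (this.mpr hr), if_pos hr, hr]; ring
          · rw [if_neg (mt this.mp hr), if_neg hr, mul_zero]
      _ = 4 * signChar (h p) := by simp
  lia

/-- Arrays `σ` of permutations of `𝔽₂ᵗ`, indexed by two points `i, j` of `𝔽₂²`, with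
`∑ⱼ σᵢⱼ⁻¹ = 0` for all `i` and `∑ᵢ σᵢⱼ = 0` for all `j`. -/
abbrev PermArray (t : ℕ) : Type :=
  {s : BV 2 → {r : BV 2 → Equiv.Perm (BV t) // ∑ j, (fun w => (r j).symm w) = (0 : BV t → BV t)} //
    ∑ i, (fun j x => (s i).1 j x) = (0 : BV 2 → BV t → BV t)}

namespace PermArray

variable {t : ℕ} (s : PermArray t)

/-- The permutation at position `(i, j)`. -/
def perm (i j : BV 2) : Equiv.Perm (BV t) := (s.1 i).1 j

lemma sum_perm (j : BV 2) (x : BV t) : ∑ i, s.perm i j x = 0 := by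
  simpa [perm, Finset.sum_apply] using congrFun (congrFun s.2 j) x

lemma sum_perm_symm (i : BV 2) (w : BV t) : ∑ j, (s.perm i j).symm w = 0 := by
  simpa [perm, Finset.sum_apply] using congrFun (s.1 i).2 w

/-- The partial dual, in the variable `i`, of the bent function attached to a permutation array. -/
def partialDual (j : BV 2) (x g : BV t) (i : BV 2) : ZMod 2 :=
  quad i + (quad j + ip (s.perm i j x) g)

lemma sum_partialDual (j : BV 2) (x g : BV t) : ∑ i, s.partialDual j x g i = 1 := by
  have h4 : ∑ _i : BV 2, quad j = 0 := by
    generalize quad j = c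
    rw [sum_BV_two]; revert c; decide
  simp only [partialDual, Finset.sum_add_distrib, sum_quad, h4, sum_ip_left, s.sum_perm]
  simp [ip]

/-- The bent function attached to a permutation array, in split variables. -/
def bentFun (z : (BV 2 × BV 2) × (BV t × BV t)) : ZMod 2 :=
  dualTwo (s.partialDual z.1.2 z.2.1 z.2.2) z.1.1

lemma sum_sum_signChar_perm (π : Equiv.Perm (BV t)) (u w : BV t) :
    ∑ x, ∑ g, signChar (ip (π x) g + (ip x u + ip g w)) =
      2 ^ t * signChar (ip (π.symm w) u) := by
  have h : ∀ x, ∑ g, signChar (ip (π x) g + (ip x u + ip g w)) =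
      if x = π.symm w then 2 ^ t * signChar (ip (π.symm w) u) else 0 := by
    intro x
    have h1 : ∀ g, signChar (ip (π x) g + (ip x u + ip g w)) =
        signChar (ip x u) * signChar (ip g (π x + w)) := by
      intro g
      rw [← signChar_add, ip_add, ip_comm g (π x)]
      congr 1; ring
    simp only [h1]
    rw [← Finset.mul_sum, sum_signChar_ip]
    have h2 : π x + w = 0 ↔ x = π.symm w := by
      rw [Equiv.eq_symm_apply]
      constructor
      · intro h
        rw [← add_zero (π x), ← add_self_eq_zero_BV w, ← add_assoc, h, zero_add]
      · intro h; rw [h]; exact add_self_eq_zero_BV w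
    by_cases hx : x = π.symm w
    · rw [if_pos (h2.mpr hx), if_pos hx, hx, mul_comm]
    · rw [if_neg (mt h2.mp hx), if_neg hx, mul_zero]
  simp [h]

lemma abs_sum_bentFun (i k : BV 2) (u w : BV t) :
    |∑ z : (BV 2 × BV 2) × (BV t × BV t), signChar (s.bentFun z +
      ((ip z.1.1 i + ip z.1.2 k) + (ip z.2.1 u + ip z.2.2 w)))| = 2 ^ (t + 2) := by
  have key : ∑ z : (BV 2 × BV 2) × (BV t × BV t), signChar (s.bentFun z +
      ((ip z.1.1 i + ip z.1.2 k) + (ip z.2.1 u + ip z.2.2 w))) =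
      2 ^ (t + 1) * signChar (quad i) *
        ∑ j, signChar ((quad j + ip ((s.perm i j).symm w) u) + ip j k) := by
    calc _ = ∑ j, ∑ x, ∑ g, ∑ i', signChar (ip j k + (ip x u + ip g w)) *
            signChar (dualTwo (s.partialDual j x g) i' + ip i' i) := by
          simp only [Fintype.sum_prod_type, bentFun]
          rw [Finset.sum_comm]
          refine Finset.sum_congr rfl fun j _ => ?_
          rw [Finset.sum_comm]
          refine Finset.sum_congr rfl fun x _ => ?_
          rw [Finset.sum_comm]
          refine Finset.sum_congr rfl fun g _ => Finset.sum_congr rfl fun i' _ => ?_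
          rw [← signChar_add]
          congr 1; ring
      _ = ∑ j, 2 * signChar (quad i) * signChar (quad j + ip j k) *
            ∑ x, ∑ g, signChar (ip (s.perm i j x) g + (ip x u + ip g w)) := by
          refine Finset.sum_congr rfl fun j _ => ?_
          rw [Finset.mul_sum]
          refine Finset.sum_congr rfl fun x _ => ?_
          rw [Finset.mul_sum]
          refine Finset.sum_congr rfl fun g _ => ?_
          rw [← Finset.mul_sum, walsh_dualTwo (s.sum_partialDual j x g)]
          simp only [partialDual, signChar_add]
          ring
      _ = _ := by
          rw [Finset.mul_sum]
          refine Finset.sum_congr rfl fun j _ => ?_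
          rw [sum_sum_signChar_perm]
          simp only [signChar_add]
          ring
  have hodd : ∑ j, (quad j + ip ((s.perm i j).symm w) u) = 1 := by
    rw [Finset.sum_add_distrib, sum_quad, sum_ip_left, s.sum_perm_symm]
    simp [ip]
  rw [key, abs_mul, abs_mul, abs_signChar, abs_walsh_two hodd, abs_of_pos (by positivity)]
  ring

lemma bentFun_injective : Function.Injective (bentFun (t := t)) := by
  intro s s' h
  have hperm : ∀ i j, s.perm i j = s'.perm i j := by
    intro i j
    ext1 x
    refine ip_left_injective fun g => ?_
    have h1 := walsh_dualTwo (s.sum_partialDual j x g) i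
    have h2 := walsh_dualTwo (s'.sum_partialDual j x g) i
    have h3 : dualTwo (s.partialDual j x g) = dualTwo (s'.partialDual j x g) :=
      funext fun i' => congrFun h ((i', j), (x, g))
    rw [h3, h2] at h1
    have h4 := signChar_injective (mul_left_cancel₀ two_ne_zero h1)
    simpa [partialDual] using h4.symm
  exact Subtype.ext (funext fun i => Subtype.ext (funext fun j => hperm i j))

end PermArray

/-- Splitting of `2 t + 4` coordinates into groups of `2`, `2`, `t` and `t`. -/
def splitIndex (t : ℕ) : (Fin 2 ⊕ Fin 2) ⊕ (Fin t ⊕ Fin t) ≃ Fin (2 * t + 4) :=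
  ((finSumFinEquiv.sumCongr finSumFinEquiv).trans finSumFinEquiv).trans (finCongr (by ring))

/-- The corresponding splitting of vectors. -/
def splitVec (t : ℕ) : BV (2 * t + 4) ≃ (BV 2 × BV 2) × (BV t × BV t) :=
  ((splitIndex t).symm.arrowCongr (Equiv.refl _)).trans
    ((Equiv.sumArrowEquivProdArrow _ _ _).trans
      ((Equiv.sumArrowEquivProdArrow _ _ _).prodCongr (Equiv.sumArrowEquivProdArrow _ _ _)))

lemma ip_eq_splitVec (t : ℕ) (x y : BV (2 * t + 4)) :
    ip x y = (ip (splitVec t x).1.1 (splitVec t y).1.1 + ip (splitVec t x).1.2 (splitVec t y).1.2) +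
      (ip (splitVec t x).2.1 (splitVec t y).2.1 + ip (splitVec t x).2.2 (splitVec t y).2.2) := by
  simp only [ip]
  rw [← (splitIndex t).sum_comp, Fintype.sum_sum_type, Fintype.sum_sum_type, Fintype.sum_sum_type]
  rfl

lemma PermArray.isBent {t : ℕ} (s : PermArray t) :
    IsBent (2 * t + 4) (fun x => s.bentFun (splitVec t x)) := by
  intro y
  have h := s.abs_sum_bentFun (splitVec t y).1.1 (splitVec t y).1.2 (splitVec t y).2.1
    (splitVec t y).2.2
  rw [← (splitVec t).sum_comp] at h
  have hn : (2 * t + 4) / 2 = t + 2 := by lia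
  rw [hn, ← h]
  simp only [walsh, signChar, ip_eq_splitVec]

lemma card_permArray_le_bentCount (t : ℕ) : Nat.card (PermArray t) ≤ bentCount (2 * t + 4) := by
  refine Nat.card_le_card_of_injective
    (fun s : PermArray t => (⟨_, s.isBent⟩ : {f // IsBent (2 * t + 4) f})) ?_
  intro s s' h
  refine PermArray.bentFun_injective (funext fun z => ?_)
  simpa using congrFun (congrArg Subtype.val h) ((splitVec t).symm z)

/-- Cauchy–Schwarz: the number of pairs on which a map takes equal values. -/
lemma card_sq_le_card_mul_card_collisions {α β : Type*} [Finite α] [Finite β] (φ : α → β) :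
    Nat.card α ^ 2 ≤ Nat.card β * Nat.card {u : α × α // φ u.1 = φ u.2} := by
  classical
  have := Fintype.ofFinite α
  have := Fintype.ofFinite β
  have h1 : Nat.card α = ∑ b : β, (Finset.univ.filter fun a => φ a = b).card := by
    rw [Nat.card_eq_fintype_card, ← Finset.card_univ]
    exact Finset.card_eq_sum_card_fiberwise fun _ _ => Finset.mem_coe.mpr (Finset.mem_univ _)
  have h2 : Nat.card {u : α × α // φ u.1 = φ u.2} =
      ∑ b : β, (Finset.univ.filter fun a => φ a = b).card ^ 2 := by
    rw [Nat.card_eq_fintype_card, Fintype.card_subtype,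
      Finset.card_eq_sum_card_fiberwise (f := fun u : α × α => φ u.1) (t := Finset.univ)
        fun _ _ => Finset.mem_coe.mpr (Finset.mem_univ _)]
    refine Finset.sum_congr rfl fun b _ => ?_
    rw [sq, ← Finset.card_product]
    congr 1
    ext u
    simp only [Finset.mem_filter, Finset.mem_univ, true_and, Finset.mem_product]
    constructor
    · rintro ⟨h, rfl⟩; exact ⟨rfl, h.symm⟩
    · rintro ⟨h, h'⟩; exact ⟨h.trans h'.symm, h⟩
  rw [h1, h2, Nat.card_eq_fintype_card, ← Finset.card_univ]
  exact sq_sum_le_card_mul_sum_sq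

/-- In a group of exponent two, at least the average proportion of quadruples has sum zero. -/
lemma card_pow_four_le {α H : Type*} [Finite α] [AddCommGroup H] [Finite H]
    (hH : ∀ h : H, h + h = 0) (ψ : α → H) :
    Nat.card α ^ 4 ≤ Nat.card H * Nat.card {a : BV 2 → α // ∑ p, ψ (a p) = 0} := by
  have h := card_sq_le_card_mul_card_collisions (fun u : α × α => ψ u.1 + ψ u.2)
  rw [Nat.card_prod] at h
  calc Nat.card α ^ 4 = (Nat.card α * Nat.card α) ^ 2 := by ring
    _ ≤ _ := h
    _ ≤ _ := Nat.mul_le_mul_left _ ?_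
  refine Nat.card_le_card_of_injective
    (fun u => ⟨fun p => if p 0 = 0 then (if p 1 = 0 then u.1.1.1 else u.1.1.2)
      else (if p 1 = 0 then u.1.2.1 else u.1.2.2), ?_⟩) ?_
  · rw [sum_BV_two]
    simp only [Matrix.cons_val_zero, Matrix.cons_val_one, if_true, one_ne_zero, if_false]
    rw [u.2]
    exact hH _
  · intro u v huv
    have hp := fun p => congrFun (congrArg Subtype.val huv) p
    have h00 := hp ![0, 0]
    have h01 := hp ![0, 1]
    have h10 := hp ![1, 0]
    have h11 := hp ![1, 1]
    simp only [Matrix.cons_val_zero, Matrix.cons_val_one, if_true, one_ne_zero, if_false]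
      at h00 h01 h10 h11
    exact Subtype.ext (Prod.ext (Prod.ext h00 h01) (Prod.ext h10 h11))

lemma card_BV (t : ℕ) : Nat.card (BV t) = 2 ^ t := by
  simp

lemma pow_sixteen_le {F P N b : ℕ} (h1 : F ^ 4 ≤ P * N) (h3 : N ^ 4 ≤ P ^ 4 * b) :
    F ^ 16 ≤ P ^ 8 * b := by
  calc F ^ 16 = (F ^ 4) ^ 4 := by ring
    _ ≤ (P * N) ^ 4 := Nat.pow_le_pow_left h1 4
    _ = P ^ 4 * N ^ 4 := mul_pow _ _ _
    _ ≤ P ^ 4 * (P ^ 4 * b) := Nat.mul_le_mul_left _ h3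
    _ = P ^ 8 * b := by ring

lemma factorial_pow_le (t : ℕ) :
    (2 ^ t).factorial ^ 16 ≤ ((2 ^ t) ^ (2 ^ t)) ^ 8 * bentCount (2 * t + 4) := by
  have h1 := card_pow_four_le (H := BV t → BV t)
    (fun h => funext fun _ => add_self_eq_zero_BV _)
    (fun (σ : Equiv.Perm (BV t)) w => σ.symm w)
  have h2 := card_pow_four_le (H := BV 2 → BV t → BV t)
    (fun h => funext fun _ => funext fun _ => add_self_eq_zero_BV _)
    (fun (r : {r : BV 2 → Equiv.Perm (BV t) //
      ∑ j, (fun w => (r j).symm w) = (0 : BV t → BV t)}) j x => r.1 j x)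
  have h3 := h2.trans (Nat.mul_le_mul_left _ (card_permArray_le_bentCount t))
  rw [Nat.card_perm, Nat.card_fun (α := BV t), card_BV] at h1
  rw [Nat.card_fun (α := BV 2), Nat.card_fun (α := BV t), card_BV, card_BV] at h3
  exact pow_sixteen_le h1 h3

lemma le_logb_two_factorial (t : ℕ) :
    (t : ℝ) * 2 ^ t - 2 * 2 ^ t ≤ Real.logb 2 (2 ^ t).factorial := by
  have h := Real.pow_div_factorial_le_exp (x := ((2 ^ t : ℕ) : ℝ)) (by positivity) (2 ^ t)
  have he : Real.exp ((2 ^ t : ℕ) : ℝ) ≤ 4 ^ (2 ^ t) := by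
    rw [← mul_one ((2 ^ t : ℕ) : ℝ), Real.exp_nat_mul]
    exact pow_le_pow_left₀ (Real.exp_pos _).le (by linarith [Real.exp_one_lt_d9]) _
  have hf : (0 : ℝ) < ((2 ^ t).factorial : ℝ) := by exact_mod_cast Nat.factorial_pos _
  have h1 := (div_le_iff₀ hf).mp (h.trans he)
  have h2 := Real.logb_le_logb_of_le one_lt_two (by positivity) h1
  rw [Real.logb_mul (by positivity) hf.ne', Real.logb_pow, Real.logb_pow] at h2
  have h4 : Real.logb 2 4 = 2 := by
    rw [show (4 : ℝ) = 2 ^ 2 by norm_num, Real.logb_pow, Real.logb_self_eq_one one_lt_two]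
    norm_num
  rw [h4] at h2
  push_cast at h2 ⊢
  rw [Real.logb_pow, Real.logb_self_eq_one one_lt_two] at h2
  linarith

lemma le_logb_bentCount (t : ℕ) :
    8 * (t : ℝ) * 2 ^ t - 32 * 2 ^ t ≤ Real.logb 2 (bentCount (2 * t + 4)) := by
  have h := factorial_pow_le t
  have hf : (0 : ℝ) < ((2 ^ t).factorial : ℝ) := by exact_mod_cast Nat.factorial_pos _
  have hb : ((bentCount (2 * t + 4) : ℕ) : ℝ) ≠ 0 := by
    intro h0
    rw [Nat.cast_eq_zero.mp h0, mul_zero] at h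
    exact (Nat.pos_of_ne_zero (pow_ne_zero 16 (Nat.factorial_ne_zero _))).not_ge h
  have h1 : ((2 ^ t).factorial : ℝ) ^ 16 ≤
      ((2 ^ t) ^ (2 ^ t)) ^ 8 * (bentCount (2 * t + 4) : ℝ) := by exact_mod_cast h
  have h2 := Real.logb_le_logb_of_le one_lt_two (by positivity) h1
  rw [Real.logb_mul (by positivity) hb, Real.logb_pow, Real.logb_pow, Real.logb_pow,
    Real.logb_pow, Real.logb_self_eq_one one_lt_two] at h2
  push_cast at h2
  linarith [le_logb_two_factorial t]

/-- there is a constant `C > 0` such that for every even `n ≥ 4`,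
`log₂ b_n ≥ n·2^{n/2} − C·2^{n/2}`, i.e. `log₂ b_n ≥ n·2^{n/2}(1 + O(1/n))`. -/
theorem stmt_2 : ∃ C : ℝ, 0 < C ∧ ∀ n : ℕ, Even n → 4 ≤ n →
    (n : ℝ) * 2 ^ (n / 2) - C * 2 ^ (n / 2) ≤ Real.logb 2 (bentCount n) := by
  refine ⟨12, by norm_num, fun n hn h4 => ?_⟩
  obtain ⟨t, rfl⟩ : ∃ t, n = 2 * t + 4 := by
    obtain ⟨r, rfl⟩ := hn
    exact ⟨r - 2, by lia⟩
  have hdiv : (2 * t + 4) / 2 = t + 2 := by lia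
  rw [hdiv, pow_add]
  push_cast
  linarith [le_logb_bentCount t]
end

section
/- For every even integer n ≥ 4, the number of ordered quadruples (A, B, C, D) ∈ M_n⁴ such that A and B have the same vertical signature, C and D have the same vertical signature, A and C have the same horizontal signature, and B and D have the same horizontal signature, is at least m_n⁴/s_n⁴ (equivalently, s_n⁴ times the number of such quadruples is at least m_n⁴). -/
/-- Membership in `M_n` (with `m = n/2 - 1`): a binary matrix indexed by
`𝔽₂ᵐ × 𝔽₂ᵐ` with exactly two nonzero entries in each row and each column. -/
def InM {m : ℕ} (E : BV m × BV m → Fin 2) : Prop :=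
  (∀ i, (Finset.univ.filter (fun j => E (i, j) = 1)).card = 2) ∧
  (∀ j, (Finset.univ.filter (fun i => E (i, j) = 1)).card = 2)

/-- The vertical signature: to each row index `i` it assigns the XOR (sum in `𝔽₂ᵐ`)
of the column indices of the nonzero entries in row `i`. -/
def vsig {m : ℕ} (E : BV m × BV m → Fin 2) (i : BV m) : BV m :=
  ∑ j ∈ Finset.univ.filter (fun j => E (i, j) = 1), j

/-- The horizontal signature: to each column index `j` it assigns the XOR of the
row indices of the nonzero entries in column `j`. -/
def hsig {m : ℕ} (E : BV m × BV m → Fin 2) (j : BV m) : BV m :=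
  ∑ i ∈ Finset.univ.filter (fun i => E (i, j) = 1), i

/-- `m_n = |M_n|` (stated with `m = n/2 - 1`). -/
noncomputable def mCount (m : ℕ) : ℕ :=
  Nat.card {E : BV m × BV m → Fin 2 // InM E}

/-- `s_n`, the number of distinct vertical signatures of elements of `M_n`
(stated with `m = n/2 - 1`). -/
noncomputable def sCount (m : ℕ) : ℕ :=
  Set.ncard {σ : BV m → BV m | ∃ E, InM E ∧ vsig E = σ}

open Classical in
/-- Cauchy–Schwarz for the number of pairs of elements with equal image. -/
theorem card_sq_le_card_mul_card_eq_pairs {α β : Type*} (S : Finset α) (T : Finset β)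
    (f : α → β) (hf : ∀ a ∈ S, f a ∈ T) :
    S.card ^ 2 ≤ T.card * ((S ×ˢ S).filter (fun p => f p.1 = f p.2)).card := by
  have h1 : S.card = ∑ t ∈ T, (S.filter (fun a => f a = t)).card :=
    Finset.card_eq_sum_card_fiberwise hf
  have h2 : ((S ×ˢ S).filter (fun p => f p.1 = f p.2)).card =
      ∑ t ∈ T, (S.filter (fun a => f a = t)).card ^ 2 := by
    rw [Finset.card_eq_sum_card_fiberwise (f := fun p => f p.1) (t := T)]
    · refine Finset.sum_congr rfl fun t _ => ?_
      rw [sq, ← Finset.card_product]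
      congr 1
      ext ⟨a, b⟩
      simp only [Finset.mem_filter, Finset.mem_product]
      grind
    · intro p hp
      simp only [Finset.coe_filter, Finset.mem_product, Set.mem_ofPred_eq] at hp
      exact hf _ hp.1.1
  rw [h2, h1]
  exact sq_sum_le_card_mul_sum_sq

open Classical in
/-- The lower bound for the number of 4-cycles in a bipartite multigraph whose edges `a ∈ S` join
`f a` to `g a`. -/
theorem card_pow_four_le_card_four_cycles {α β γ : Type*} (S : Finset α) (T : Finset β)
    (U : Finset γ) (f : α → β) (g : α → γ) (hf : ∀ a ∈ S, f a ∈ T) (hg : ∀ a ∈ S, g a ∈ U) :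
    S.card ^ 4 ≤ T.card ^ 2 * U.card ^ 2 *
      (((S ×ˢ S) ×ˢ (S ×ˢ S)).filter (fun q => f q.1.1 = f q.1.2 ∧ f q.2.1 = f q.2.2 ∧
        g q.1.1 = g q.2.1 ∧ g q.1.2 = g q.2.2)).card := by
  set P := (S ×ˢ S).filter (fun p => f p.1 = f p.2) with hP
  have h1 : S.card ^ 2 ≤ T.card * P.card := card_sq_le_card_mul_card_eq_pairs S T f hf
  have h2 := card_sq_le_card_mul_card_eq_pairs P (U ×ˢ U) (fun p => (g p.1, g p.2)) (by
    intro p hp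
    simp only [hP, Finset.mem_filter, Finset.mem_product] at hp
    exact Finset.mk_mem_product (hg _ hp.1.1) (hg _ hp.1.2))
  have h3 : P.card ^ 2 ≤ U.card * U.card *
      (((S ×ˢ S) ×ˢ (S ×ˢ S)).filter (fun q => f q.1.1 = f q.1.2 ∧ f q.2.1 = f q.2.2 ∧
        g q.1.1 = g q.2.1 ∧ g q.1.2 = g q.2.2)).card := by
    rw [Finset.card_product] at h2
    convert h2 using 3
    ext q
    simp only [hP, Finset.mem_filter, Finset.mem_product, Prod.mk.injEq]
    tauto
  calc S.card ^ 4 = (S.card ^ 2) ^ 2 := by ring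
    _ ≤ (T.card * P.card) ^ 2 := Nat.pow_le_pow_left h1 2
    _ = T.card ^ 2 * P.card ^ 2 := by ring
    _ ≤ T.card ^ 2 * _ := Nat.mul_le_mul_left _ h3
    _ = _ := by ring

theorem setOf_hsig_eq_setOf_vsig (m : ℕ) :
    {σ : BV m → BV m | ∃ E, InM E ∧ hsig E = σ} = {σ | ∃ E, InM E ∧ vsig E = σ} := by
  ext σ
  constructor
  · rintro ⟨E, hE, rfl⟩
    exact ⟨E ∘ Prod.swap, ⟨hE.2, hE.1⟩, rfl⟩
  · rintro ⟨E, hE, rfl⟩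
    exact ⟨E ∘ Prod.swap, ⟨hE.2, hE.1⟩, rfl⟩

/-- for every even `n ≥ 4`, the number of quadruples
`(A,B,C,D) ∈ M_n⁴` with `vsig A = vsig B`, `vsig C = vsig D`,
`hsig A = hsig C`, `hsig B = hsig D` is at least `m_n⁴ / s_n⁴`,
stated as `s_n⁴ ·` (number of such quadruples) `≥ m_n⁴`. -/
theorem stmt_6 (n : ℕ) (hn : Even n) (h4 : 4 ≤ n) :
    mCount (n / 2 - 1) ^ 4 ≤ sCount (n / 2 - 1) ^ 4 *
      Nat.card {q : (BV (n / 2 - 1) × BV (n / 2 - 1) → Fin 2) ×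
                    (BV (n / 2 - 1) × BV (n / 2 - 1) → Fin 2) ×
                    (BV (n / 2 - 1) × BV (n / 2 - 1) → Fin 2) ×
                    (BV (n / 2 - 1) × BV (n / 2 - 1) → Fin 2) //
        InM q.1 ∧ InM q.2.1 ∧ InM q.2.2.1 ∧ InM q.2.2.2 ∧
        vsig q.1 = vsig q.2.1 ∧ vsig q.2.2.1 = vsig q.2.2.2 ∧
        hsig q.1 = hsig q.2.2.1 ∧ hsig q.2.1 = hsig q.2.2.2} := by
  classical
  generalize n / 2 - 1 = m
  let S : Finset (BV m × BV m → Fin 2) := Finset.univ.filter InM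
  have hm : mCount m = S.card := by
    rw [mCount, Nat.card_eq_fintype_card, Fintype.card_subtype]
  have hT : (S.image vsig).card = sCount m := by
    rw [sCount, ← Set.ncard_coe_finset]
    congr 1
    ext σ
    simp [S]
  have hU : (S.image hsig).card = sCount m := by
    rw [sCount, ← setOf_hsig_eq_setOf_vsig, ← Set.ncard_coe_finset]
    congr 1
    ext σ
    simp [S]
  have key := card_pow_four_le_card_four_cycles S (S.image vsig) (S.image hsig) vsig hsig
    (fun _ => Finset.mem_image_of_mem _) (fun _ => Finset.mem_image_of_mem _)
  rw [hT, hU, ← pow_add] at key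
  rw [hm]
  refine key.trans (Nat.mul_le_mul_left _ (le_of_eq ?_))
  rw [← Finset.card_map (Equiv.prodAssoc _ _ _).toEmbedding]
  symm
  refine Nat.subtype_card _ fun q => ?_
  rw [Finset.mem_map_equiv]
  simp only [S, Finset.mem_filter, Finset.mem_product, Finset.mem_univ, true_and,
    Equiv.prodAssoc_symm_apply]
  tauto
end

section
/- Let n ≥ 4 be even, k = n/2, and let (A, B, C, D) ∈ M_n⁴ satisfy: A and B have the same vertical signature, C and D have the same vertical signature, A and C have the same horizontal signature, and B and D have the same horizontal signature. Form the block matrix E : 𝔽₂^k × 𝔽₂^k → {0,1}, identifying 𝔽₂^k with 𝔽₂ × 𝔽₂^{k−1}, by E((0,i),(0,j)) = A(i,j), E((0,i),(1,j)) = B(i,j), E((1,i),(0,j)) = C(i,j), E((1,i),(1,j)) = D(i,j). Then for every row index r ∈ 𝔽₂^k the set {c : E(r,c) = 1} is a coset of a 2-dimensional linear subspace of 𝔽₂^k (in particular it has exactly 4 elements), and likewise for every column index c the set {r : E(r,c) = 1} is a coset of a 2-dimensional linear subspace of 𝔽₂^k. -/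
/-- The block matrix `(A B; C D)` indexed by `𝔽₂^k ≃ 𝔽₂ × 𝔽₂^{k−1}`. -/
def blockE {m : ℕ} (A B C D : BV m × BV m → Fin 2) :
    (ZMod 2 × BV m) × (ZMod 2 × BV m) → Fin 2 := fun p =>
  if p.1.1 = 0 then
    (if p.2.1 = 0 then A (p.1.2, p.2.2) else B (p.1.2, p.2.2))
  else
    (if p.2.1 = 0 then C (p.1.2, p.2.2) else D (p.1.2, p.2.2))

/-- `S` is a coset of a 2-dimensional linear subspace of `𝔽₂ × 𝔽₂^{k−1} ≃ 𝔽₂^k`. -/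
def IsCoset2 {m : ℕ} (S : Set (ZMod 2 × BV m)) : Prop :=
  ∃ W : Submodule (ZMod 2) (ZMod 2 × BV m), Module.finrank (ZMod 2) W = 2 ∧
    ∃ a : ZMod 2 × BV m, S = {v | ∃ w ∈ W, v = a + w}

/-- Two pairs with the same sum, placed in the two halves of `𝔽₂ × 𝔽₂ᵐ`, form a coset of a
2-dimensional subspace. -/
theorem isCoset2_of_sum_eq {m : ℕ} {S T : Finset (BV m)} (hS : S.card = 2) (hT : T.card = 2)
    (h : ∑ j ∈ S, j = ∑ j ∈ T, j) :
    IsCoset2 {c : ZMod 2 × BV m | c.2 ∈ if c.1 = 0 then S else T} := by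
  obtain ⟨x, y, hxy, rfl⟩ := Finset.card_eq_two.mp hS
  obtain ⟨z, w, hzw, rfl⟩ := Finset.card_eq_two.mp hT
  rw [Finset.sum_pair hxy, Finset.sum_pair hzw] at h
  have two (v : BV m) : v + v = 0 := funext fun i => CharTwo.add_self_eq_zero (v i)
  have hx : x + (x + y) = y := by rw [← add_assoc, two, zero_add]
  have hz : x + (x + z) = z := by rw [← add_assoc, two, zero_add]
  have hw : x + (x + y + (x + z)) = w := by
    rw [← add_assoc, hx, add_left_comm, ← add_assoc, h, add_right_comm, two, zero_add]
  have hd : x + y ≠ 0 := fun h0 => hxy (by simpa [h0] using hx)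
  have scalar (b : ZMod 2) : b = 0 ∨ b = 1 := by revert b; decide
  have hli : LinearIndependent (ZMod 2)
      ![((0 : ZMod 2), x + y), ((1 : ZMod 2), x + z)] := by
    rw [LinearIndependent.pair_iff]
    intro s t hst
    have ht : t = 0 := by simpa using congrArg Prod.fst hst
    subst ht
    have hs : s • (x + y) = 0 := by simpa using congrArg Prod.snd hst
    exact ⟨(smul_eq_zero.mp hs).resolve_right hd, rfl⟩
  refine ⟨Submodule.span (ZMod 2) (Set.range ![((0 : ZMod 2), x + y), ((1 : ZMod 2), x + z)]),
    by simpa using finrank_span_eq_card hli, (0, x), ?_⟩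
  ext ⟨b, v⟩
  simp only [Set.mem_ofPred_eq, Matrix.range_cons, Matrix.range_empty, Set.union_empty,
    Set.singleton_union, Submodule.mem_span_pair]
  constructor
  · intro hv
    rcases scalar b with rfl | rfl
    · simp only [if_true, Finset.mem_insert, Finset.mem_singleton] at hv
      rcases hv with rfl | rfl
      · exact ⟨_, ⟨0, 0, rfl⟩, by simp⟩
      · exact ⟨_, ⟨1, 0, rfl⟩, by simp [hx]⟩
    · simp only [one_ne_zero, if_false, Finset.mem_insert, Finset.mem_singleton] at hv
      rcases hv with rfl | rfl
      · exact ⟨_, ⟨0, 1, rfl⟩, by simp [hz]⟩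
      · exact ⟨_, ⟨1, 1, rfl⟩, by simp [hw]⟩
  · rintro ⟨_, ⟨s, t, rfl⟩, hv⟩
    obtain ⟨rfl, rfl⟩ := Prod.mk.inj hv
    rcases scalar s with rfl | rfl <;> rcases scalar t with rfl | rfl <;>
      simp [hx, hz, hw]

/-- if `(A,B,C,D) ∈ M_n⁴` have matching signatures
(`vsig A = vsig B`, `vsig C = vsig D`, `hsig A = hsig C`, `hsig B = hsig D`),
then in the block matrix `(A B; C D)` the support of every row and of every
column is a coset of a 2-dimensional linear subspace of `𝔽₂^{n/2}`. -/
theorem stmt_7 (n : ℕ) (hn : Even n) (h4 : 4 ≤ n)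
    (A B C D : BV (n / 2 - 1) × BV (n / 2 - 1) → Fin 2)
    (hA : InM A) (hB : InM B) (hC : InM C) (hD : InM D)
    (hAB : vsig A = vsig B) (hCD : vsig C = vsig D)
    (hAC : hsig A = hsig C) (hBD : hsig B = hsig D) :
    (∀ r : ZMod 2 × BV (n / 2 - 1), IsCoset2 {c | blockE A B C D (r, c) = 1}) ∧
    (∀ c : ZMod 2 × BV (n / 2 - 1), IsCoset2 {r | blockE A B C D (r, c) = 1}) := by
  refine ⟨?_, ?_⟩
  · rintro ⟨b, i⟩
    by_cases hb : b = 0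
    · convert isCoset2_of_sum_eq (hA.1 i) (hB.1 i) (congrFun hAB i) using 2
      ext c
      by_cases hc : c.1 = 0 <;> simp [blockE, hb, hc]
    · convert isCoset2_of_sum_eq (hC.1 i) (hD.1 i) (congrFun hCD i) using 2
      ext c
      by_cases hc : c.1 = 0 <;> simp [blockE, hb, hc]
  · rintro ⟨b, j⟩
    by_cases hb : b = 0
    · convert isCoset2_of_sum_eq (hA.2 j) (hC.2 j) (congrFun hAC j) using 2
      ext r
      by_cases hr : r.1 = 0 <;> simp [blockE, hb, hr]
    · convert isCoset2_of_sum_eq (hB.2 j) (hD.2 j) (congrFun hBD j) using 2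
      ext r
      by_cases hr : r.1 = 0 <;> simp [blockE, hb, hr]
end

section
/- Let n ≥ 4 be even, k = n/2, and let (A, B, C, D) ∈ M_n⁴ satisfy the matching-signature conditions (A and B share a vertical signature, C and D share a vertical signature, A and C share a horizontal signature, B and D share a horizontal signature), and let E : 𝔽₂^k × 𝔽₂^k → {0,1} be the corresponding block matrix. Then there exist at least 32 distinct functions σ : {(r,c) : E(r,c)=1} → {+1, −1} such that in every row of E the number of nonzero entries with sign +1 is odd, and in every column of E the number of nonzero entries with sign +1 is odd. -/
/-- A matrix of `M_n` contains the graph of a permutation (Hall's theorem for a 2-regular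
bipartite graph). -/
theorem InM.exists_perm {m : ℕ} {E : BV m × BV m → Fin 2} (hE : InM E) :
    ∃ π : Equiv.Perm (BV m), ∀ i, E (i, π i) = 1 := by
  classical
  have hall : ∀ S : Finset (BV m),
      S.card ≤ (S.biUnion fun i => Finset.univ.filter fun j => E (i, j) = 1).card := by
    intro S
    have h := Finset.card_mul_le_card_mul (fun i j => E (i, j) = 1) (s := S)
      (t := S.biUnion fun i => Finset.univ.filter fun j => E (i, j) = 1) (m := 2) (n := 2)
      (fun i hi => by
        refine (hE.1 i).ge.trans (Finset.card_le_card fun j hj => ?_)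
        rw [Finset.mem_bipartiteAbove]
        exact ⟨Finset.mem_biUnion.2 ⟨i, hi, hj⟩, (Finset.mem_filter.1 hj).2⟩)
      (fun j _ => by
        refine (Finset.card_le_card fun i hi => ?_).trans (hE.2 j).le
        exact Finset.mem_filter.2 ⟨Finset.mem_univ _, ((Finset.mem_bipartiteBelow _).1 hi).2⟩)
    omega
  obtain ⟨f, hf, hmem⟩ := (Finset.all_card_le_biUnion_card_iff_exists_injective _).1 hall
  exact ⟨Equiv.ofBijective f (Finite.injective_iff_bijective.1 hf),
    fun i => (Finset.mem_filter.1 (hmem i)).2⟩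

/-- Every block of the block matrix of four elements of `M_n` lies in `M_n`. -/
theorem inM_blockE {m : ℕ} {A B C D : BV m × BV m → Fin 2}
    (hA : InM A) (hB : InM B) (hC : InM C) (hD : InM D) (a b : ZMod 2) :
    InM fun p : BV m × BV m => blockE A B C D ((a, p.1), (b, p.2)) := by
  by_cases ha : a = 0 <;> by_cases hb : b = 0 <;> simpa [blockE, ha, hb]

/-- The `𝔽₂`-valued sign pattern which is constantly `s a b` on the block `(a, b)`, with the
permutation `π a b` added on the two blocks with `a + b = t`. -/
def signBit {m : ℕ} (π : ZMod 2 → ZMod 2 → Equiv.Perm (BV m)) (t : ZMod 2)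
    (s : ZMod 2 → ZMod 2 → ZMod 2) (p : (ZMod 2 × BV m) × (ZMod 2 × BV m)) : ZMod 2 :=
  s p.1.1 p.2.1 + if p.1.1 + p.2.1 = t ∧ π p.1.1 p.2.1 p.1.2 = p.2.2 then 1 else 0

theorem sum_signBit_row {m : ℕ} {E : (ZMod 2 × BV m) × (ZMod 2 × BV m) → Fin 2}
    (hE : ∀ a b, InM fun p : BV m × BV m => E ((a, p.1), (b, p.2)))
    {π : ZMod 2 → ZMod 2 → Equiv.Perm (BV m)} (hπ : ∀ a b i, E ((a, i), (b, π a b i)) = 1)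
    (t : ZMod 2) (s : ZMod 2 → ZMod 2 → ZMod 2) (r : ZMod 2 × BV m) :
    ∑ c, (if E (r, c) = 1 then signBit π t s (r, c) else 0) = 1 := by
  obtain ⟨a, i⟩ := r
  have hblock : ∀ b, ∑ j, (if E ((a, i), (b, j)) = 1 then
      signBit π t s ((a, i), (b, j)) else 0) = if b = t - a then 1 else 0 := by
    intro b
    have hsplit : ∀ j, (if E ((a, i), (b, j)) = 1 then signBit π t s ((a, i), (b, j)) else 0)
        = (if E ((a, i), (b, j)) = 1 then s a b else 0) +
          if π a b i = j then (if b = t - a then 1 else 0) else 0 := by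
      intro j
      have := hπ a b i
      simp only [signBit, eq_sub_iff_add_eq']
      grind
    rw [Finset.sum_congr rfl fun j _ => hsplit j, Finset.sum_add_distrib, ← Finset.sum_filter,
      Finset.sum_const, (hE a b).1 i, CharTwo.two_nsmul, zero_add, Finset.sum_ite_eq]
    simp
  rw [Fintype.sum_prod_type, Finset.sum_congr rfl fun b _ => hblock b]
  simp

theorem sum_signBit_col {m : ℕ} {E : (ZMod 2 × BV m) × (ZMod 2 × BV m) → Fin 2}
    (hE : ∀ a b, InM fun p : BV m × BV m => E ((a, p.1), (b, p.2)))
    {π : ZMod 2 → ZMod 2 → Equiv.Perm (BV m)} (hπ : ∀ a b i, E ((a, i), (b, π a b i)) = 1)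
    (t : ZMod 2) (s : ZMod 2 → ZMod 2 → ZMod 2) (c : ZMod 2 × BV m) :
    ∑ r, (if E (r, c) = 1 then signBit π t s (r, c) else 0) = 1 := by
  rw [← sum_signBit_row (E := fun p => E (p.2, p.1)) (π := fun b a => (π a b).symm)
    (fun b a => ⟨(hE a b).2, (hE a b).1⟩)
    (fun b a j => by simpa using hπ a b ((π a b).symm j)) t (fun b a => s a b) c]
  refine Finset.sum_congr rfl fun r _ => ?_
  simp only [signBit, add_comm c.1, Equiv.symm_apply_eq, eq_comm (a := c.2)]

/-- Distinct parameters give sign patterns that differ on the support of the matrix. -/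
theorem signBit_injective {m : ℕ} {E : (ZMod 2 × BV m) × (ZMod 2 × BV m) → Fin 2}
    (hE : ∀ a b, InM fun p : BV m × BV m => E ((a, p.1), (b, p.2)))
    {π : ZMod 2 → ZMod 2 → Equiv.Perm (BV m)} (hπ : ∀ a b i, E ((a, i), (b, π a b i)) = 1)
    {t t' : ZMod 2} {s s' : ZMod 2 → ZMod 2 → ZMod 2}
    (h : ∀ p, E p = 1 → signBit π t s p = signBit π t' s' p) : t = t' ∧ s = s' := by
  have hs : s = s' := by
    funext a b
    obtain ⟨j, hj, hne⟩ := Finset.exists_mem_ne (one_lt_two.trans_eq ((hE a b).1 0).symm)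
      (π a b 0)
    simpa [signBit, hne.symm] using h ((a, 0), (b, j)) (Finset.mem_filter.1 hj).2
  subst hs
  refine ⟨?_, rfl⟩
  simpa [signBit] using h ((0, 0), (t, π 0 t 0)) (hπ 0 t 0)

/-- The parity of the number of support points in a line that carry a one. -/
theorem odd_card_of_sum_eq_one {α β : Type*} [Fintype β]
    {E : α → Fin 2} {v : α → ZMod 2} {P : α → Prop} {g : β → α} (hg : Function.Injective g)
    (hP : ∀ p, P p ↔ p ∈ Set.range g)
    (h : ∑ x, (if E (g x) = 1 then v (g x) else 0) = 1) :
    Odd (Nat.card {q : {p // E p = 1} // P q.1 ∧ (if v q.1 = 1 then (1 : ℤ) else -1) = 1}) := by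
  let e : {x : β // E (g x) = 1 ∧ v (g x) = 1} ≃
      {q : {p // E p = 1} // P q.1 ∧ (if v q.1 = 1 then (1 : ℤ) else -1) = 1} :=
    Equiv.ofBijective
      (fun x => ⟨⟨g x.1, x.2.1⟩, (hP _).2 ⟨x.1, rfl⟩, if_pos x.2.2⟩)
      ⟨fun x y hxy => Subtype.ext (hg (congrArg (fun q => q.1.1) hxy)), by
        rintro ⟨⟨p, hp⟩, hPp, hv⟩
        obtain ⟨x, rfl⟩ := (hP p).1 hPp
        exact ⟨⟨x, hp, by by_contra hne; simp [hne] at hv⟩, rfl⟩⟩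
  rw [← Nat.card_congr e, ← ZMod.natCast_eq_one_iff_odd, Nat.card_eq_fintype_card,
    Fintype.card_subtype, Finset.card_filter, Nat.cast_sum]
  refine (Finset.sum_congr rfl fun x _ => ?_).trans h
  have key : ∀ z : ZMod 2, z = if z = 1 then 1 else 0 := by decide
  by_cases hx : E (g x) = 1
  · simpa [hx] using (key _).symm
  · simp [hx]

/-- if `(A,B,C,D) ∈ M_n⁴` have matching signatures, then the block
matrix `E = (A B; C D)` admits at least 32 distinct sign assignments
`σ : {(r,c) : E(r,c)=1} → {+1,−1}` with an odd number of `+1`s in every row and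
in every column. -/
theorem stmt_9 (n : ℕ) (hn : Even n) (h4 : 4 ≤ n)
    (A B C D : BV (n / 2 - 1) × BV (n / 2 - 1) → Fin 2)
    (hA : InM A) (hB : InM B) (hC : InM C) (hD : InM D)
    (hAB : vsig A = vsig B) (hCD : vsig C = vsig D)
    (hAC : hsig A = hsig C) (hBD : hsig B = hsig D) :
    32 ≤ Nat.card {σ : {p : (ZMod 2 × BV (n / 2 - 1)) × (ZMod 2 × BV (n / 2 - 1)) //
                          blockE A B C D p = 1} → ℤ //
      (∀ q, σ q = 1 ∨ σ q = -1) ∧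
      (∀ r : ZMod 2 × BV (n / 2 - 1),
        Odd (Nat.card {q : {p : (ZMod 2 × BV (n / 2 - 1)) × (ZMod 2 × BV (n / 2 - 1)) //
            blockE A B C D p = 1} // (q.val).1 = r ∧ σ q = 1})) ∧
      (∀ c : ZMod 2 × BV (n / 2 - 1),
        Odd (Nat.card {q : {p : (ZMod 2 × BV (n / 2 - 1)) × (ZMod 2 × BV (n / 2 - 1)) //
            blockE A B C D p = 1} // (q.val).2 = c ∧ σ q = 1}))} := by
  classical
  have hE := inM_blockE hA hB hC hD
  choose π hπ using fun a b => (hE a b).exists_perm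
  let sgn (x : ZMod 2 × (ZMod 2 → ZMod 2 → ZMod 2))
      (q : {p // blockE A B C D p = 1}) : ℤ := if signBit π x.1 x.2 q.1 = 1 then 1 else -1
  have hcard : Nat.card (ZMod 2 × (ZMod 2 → ZMod 2 → ZMod 2)) = 32 := by
    simp [Nat.card_eq_fintype_card, ZMod.card]
  rw [← hcard]
  refine @Nat.card_le_card_of_injective _ _ ?_ (fun x => ⟨sgn x, ?_, ?_, ?_⟩) ?_
  · refine Finite.of_injective (fun σ q => decide (σ.1 q = 1)) fun σ τ h => ?_
    refine Subtype.ext (funext fun q => ?_)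
    have hq := congrFun h q
    rcases σ.2.1 q with h1 | h1 <;> rcases τ.2.1 q with h2 | h2 <;> simp_all
  · intro q
    exact ite_eq_or_eq _ _ _
  · intro r
    exact odd_card_of_sum_eq_one (g := fun c => (r, c)) (P := fun p => p.1 = r)
      (fun _ _ h => congrArg Prod.snd h) (fun p => by grind)
      (sum_signBit_row hE hπ x.1 x.2 r)
  · intro c
    exact odd_card_of_sum_eq_one (g := fun r => (r, c)) (P := fun p => p.2 = c)
      (fun _ _ h => congrArg Prod.fst h) (fun p => by grind)
      (sum_signBit_col hE hπ x.1 x.2 c)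
  · intro x y hxy
    have key : ∀ z w : ZMod 2,
        (if z = 1 then (1 : ℤ) else -1) = (if w = 1 then 1 else -1) → z = w := by decide
    have h := signBit_injective hE hπ (t := x.1) (t' := y.1) (s := x.2) (s' := y.2)
      fun p hp => key _ _ (congrFun (congrArg Subtype.val hxy) ⟨p, hp⟩)
    exact Prod.ext h.1 h.2
end
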